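/- For every plane rooted tree T, the plucking polynomial Q(T) is a product of cyclotomic polynomials: there exists a finite multiset of positive integers d_1, …, d_s such that Q(T) = Π_{j=1}^{s} Φ_{d_j}(q) in ℤ[q], where Φ_d denotes the d-th cyclotomic polynomial. -/

import Mathlib

/-- A plane rooted tree: a root with an ordered list of plane rooted subtrees. -/
inductive PTree : Type where
  | node : List PTree → PTree

namespace PTree

mutual
/-- Number of edges of a plane rooted tree. -/
def edges : PTree → ℕ
  | .node l => edgesL l
def edgesL : List PTree → ℕ
  | [] => 0
  | t :: ts => (edges t + 1) + edgesL ts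
end

mutual
/-- Number of vertices of a plane rooted tree. -/
def vertices : PTree → ℕ
  | .node l => 1 + verticesL l
def verticesL : List PTree → ℕ
  | [] => 0
  | t :: ts => vertices t + verticesL ts
end

mutual
/-- `plucks T` is the list, indexed by the leaves `v` of `T`, of the pairs
`(r(T,v), T - v)`, where `r(T,v)` is the number of vertices strictly to the
right of the path from `v` to the root, and `T - v` is `T` with the leaf `v`
(and its edge) deleted. -/
def plucks : PTree → List (ℕ × PTree)
  | .node l => (plucksL l).map (fun p => (p.1, PTree.node p.2))
def plucksL : List PTree → List (ℕ × List PTree)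
  | [] => []
  | t :: ts =>
      (match t with
       | .node [] => [(verticesL ts, ts)]
       | .node (s :: ss) =>
          (plucks (.node (s :: ss))).map (fun p => (p.1 + verticesL ts, p.2 :: ts)))
      ++ (plucksL ts).map (fun p => (p.1, t :: p.2))
end

/-- The plucking polynomial, computed with a fuel parameter (the fuel is the
number of edges; each plucking removes exactly one edge). -/
noncomputable def Qfuel : ℕ → PTree → Polynomial ℤ
  | 0, _ => 1
  | (k+1), t =>
      if edges t = 0 then 1
      else ((plucks t).map (fun p => Polynomial.X ^ p.1 * Qfuel k p.2)).sum

/-- The plucking polynomial `Q(T)` of a plane rooted tree: `Q(T) = 1` if `T` has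
no edges, and otherwise `Q(T) = Σ_v q^{r(T,v)} Q(T - v)`, summed over the leaves of `T`. -/
noncomputable def Q (t : PTree) : Polynomial ℤ := Qfuel (edges t) t

end PTree

/-- The `q`-analogue `[a]_q = 1 + q + ⋯ + q^{a-1}`. -/
noncomputable def qInt (a : ℕ) : Polynomial ℤ := (Finset.range a).sum (fun i => Polynomial.X ^ i)

/-- The `q`-factorial `[a]_q! = [1]_q [2]_q ⋯ [a]_q`. -/
noncomputable def qFact : ℕ → Polynomial ℤ
  | 0 => 1
  | (a+1) => qFact a * qInt (a+1)

/-- The `q`-multinomial coefficient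
`(a₁+⋯+a_k choose a₁,…,a_k)_q = [a₁+⋯+a_k]_q! / ([a₁]_q! ⋯ [a_k]_q!)`
(the division, by a monic polynomial, is exact). -/
noncomputable def qMultinomial (l : List ℕ) : Polynomial ℤ :=
  qFact l.sum /ₘ (l.map qFact).prod

/-- The Gaussian binomial coefficient `(a+c choose a)_q`. -/
noncomputable def qBinom (a c : ℕ) : Polynomial ℤ := qMultinomial [a, c]

open Polynomial

/-- A polynomial that is a finite product of cyclotomic polynomials of positive index. -/
def IsCyclotomicProduct (p : ℤ[X]) : Prop :=
  ∃ ds : Multiset ℕ, (∀ d ∈ ds, 0 < d) ∧ p = (ds.map (fun d => cyclotomic d ℤ)).prod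

namespace IsCyclotomicProduct

theorem one : IsCyclotomicProduct 1 := ⟨0, by simp, by simp⟩

theorem mul {p q : ℤ[X]} (hp : IsCyclotomicProduct p) (hq : IsCyclotomicProduct q) :
    IsCyclotomicProduct (p * q) := by
  obtain ⟨a, ha, rfl⟩ := hp
  obtain ⟨b, hb, rfl⟩ := hq
  refine ⟨a + b, fun d hd => ?_, by simp⟩
  rcases Multiset.mem_add.1 hd with h | h
  exacts [ha d h, hb d h]

protected theorem qInt {n : ℕ} (hn : 0 < n) : IsCyclotomicProduct (qInt n) := by
  refine ⟨(n.divisors.erase 1).val, fun d hd => ?_, ?_⟩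
  · exact Nat.pos_of_mem_divisors (Finset.mem_of_mem_erase hd)
  · exact (prod_cyclotomic_eq_geom_sum hn ℤ).symm

protected theorem qFact (n : ℕ) : IsCyclotomicProduct (qFact n) := by
  induction n with
  | zero => exact one
  | succ n ih => exact ih.mul (.qInt n.succ_pos)

theorem ne_zero {p : ℤ[X]} (hp : IsCyclotomicProduct p) : p ≠ 0 := by
  obtain ⟨a, -, rfl⟩ := hp
  exact (monic_multiset_prod_of_monic a _ fun d _ => cyclotomic.monic d ℤ).ne_zero

/-- A quotient of a product of cyclotomic polynomials by one cyclotomic polynomial is again a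
product of cyclotomic polynomials. -/
theorem of_mul_cyclotomic {p : ℤ[X]} {d : ℕ} (hd : 0 < d)
    (h : IsCyclotomicProduct (p * cyclotomic d ℤ)) : IsCyclotomicProduct p := by
  obtain ⟨b, hb, h⟩ := h
  have hprime : Prime (cyclotomic d ℤ) := (cyclotomic.irreducible hd).prime
  obtain ⟨e, he, hde⟩ := hprime.exists_mem_multiset_map_dvd (h ▸ Dvd.intro_left p rfl)
  have heq : cyclotomic d ℤ = cyclotomic e ℤ :=
    eq_of_monic_of_associated (cyclotomic.monic d ℤ) (cyclotomic.monic e ℤ)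
      (hprime.irreducible.associated_of_dvd (cyclotomic.irreducible (hb e he)) hde)
  obtain ⟨c, rfl⟩ := Multiset.exists_cons_of_mem he
  refine ⟨c, fun x hx => hb x (Multiset.mem_cons_of_mem hx), ?_⟩
  rw [Multiset.map_cons, Multiset.prod_cons, ← heq, mul_comm] at h
  exact mul_left_cancel₀ hprime.ne_zero h

theorem of_mul {p q : ℤ[X]} (hq : IsCyclotomicProduct q) (h : IsCyclotomicProduct (p * q)) :
    IsCyclotomicProduct p := by
  obtain ⟨a, ha, rfl⟩ := hq
  induction a using Multiset.induction_on with
  | empty => simpa using h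
  | cons d a ih =>
    refine ih (fun x hx => ha x (Multiset.mem_cons_of_mem hx))
      (of_mul_cyclotomic (ha d (Multiset.mem_cons_self d a)) ?_)
    rwa [Multiset.map_cons, Multiset.prod_cons, mul_comm (cyclotomic d ℤ), ← mul_assoc] at h

end IsCyclotomicProduct

theorem qInt_add (m n : ℕ) : qInt (m + n) = qInt m + X ^ m * qInt n := by
  simp only [qInt, Finset.sum_range_add, Finset.mul_sum, pow_add]

namespace PTree

mutual
/-- The product of the `q`-integers `[|V(T_v)|]_q` over all vertices `v` of a tree `T`. -/
noncomputable def hook : PTree → ℤ[X]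
  | .node l => qInt (1 + verticesL l) * hookL l
/-- The product of `hook T` over the trees `T` of a forest. -/
noncomputable def hookL : List PTree → ℤ[X]
  | [] => 1
  | t :: ts => hook t * hookL ts
end

mutual
theorem isCyclotomicProduct_hook : ∀ t : PTree, IsCyclotomicProduct (hook t)
  | .node l => by
    rw [hook]
    exact (IsCyclotomicProduct.qInt (by omega)).mul (isCyclotomicProduct_hookL l)
theorem isCyclotomicProduct_hookL : ∀ l : List PTree, IsCyclotomicProduct (hookL l)
  | [] => by
    rw [hookL]
    exact .one
  | t :: ts => by
    rw [hookL]
    exact (isCyclotomicProduct_hook t).mul (isCyclotomicProduct_hookL ts)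
end

mutual
theorem vertices_eq_edges_add_one : ∀ t : PTree, vertices t = edges t + 1
  | .node l => by rw [vertices, edges, verticesL_eq_edgesL l, add_comm]
theorem verticesL_eq_edgesL : ∀ l : List PTree, verticesL l = edgesL l
  | [] => by rw [verticesL, edgesL]
  | t :: ts => by
    rw [verticesL, edgesL, vertices_eq_edges_add_one t, verticesL_eq_edgesL ts]
end

mutual
theorem vertices_of_mem_plucks :
    ∀ (t : PTree) (p : ℕ × PTree), p ∈ plucks t → vertices p.2 + 1 = vertices t
  | .node l, p, hp => by
    rw [plucks, List.mem_map] at hp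
    obtain ⟨p, hp, rfl⟩ := hp
    have := verticesL_of_mem_plucksL l p hp
    simp only [vertices]
    omega
theorem verticesL_of_mem_plucksL :
    ∀ (l : List PTree) (p : ℕ × List PTree), p ∈ plucksL l → verticesL p.2 + 1 = verticesL l
  | [], p, hp => by simp [plucksL] at hp
  | .node [] :: ts, p, hp => by
    simp only [plucksL, List.mem_append, List.mem_singleton, List.mem_map] at hp
    rcases hp with rfl | ⟨p, hp, rfl⟩
    · simp only [verticesL, vertices]
      omega
    · have := verticesL_of_mem_plucksL ts p hp
      simp only [verticesL]
      omega
  | .node (s :: ss) :: ts, p, hp => by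
    rw [plucksL, List.mem_append, List.mem_map, List.mem_map] at hp
    rcases hp with ⟨p, hp, rfl⟩ | ⟨p, hp, rfl⟩
    · have := vertices_of_mem_plucks (.node (s :: ss)) p hp
      rw [verticesL, verticesL]
      omega
    · have := verticesL_of_mem_plucksL ts p hp
      rw [verticesL, verticesL]
      omega
end

local notation "φ" => algebraMap ℤ[X] (FractionRing ℤ[X])

theorem algebraMap_ne_zero {p : ℤ[X]} (hp : IsCyclotomicProduct p) : φ p ≠ 0 :=
  (map_ne_zero_iff _ (IsFractionRing.injective ℤ[X] (FractionRing ℤ[X]))).2 hp.ne_zero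

mutual
/-- The pluckings of a tree with at least one edge, weighted by inverse hook products. -/
theorem sum_plucks_div_hook : ∀ t : PTree, edges t ≠ 0 →
    ((plucks t).map fun p => φ (X ^ p.1) / φ (hook p.2)).sum = φ (qInt (vertices t)) / φ (hook t)
  | .node l, hl => by
    have hl' : 0 < verticesL l := by
      rw [verticesL_eq_edgesL]
      rw [edges] at hl
      omega
    have h1 := algebraMap_ne_zero (.qInt hl')
    have h2 := algebraMap_ne_zero (.qInt (show 0 < 1 + verticesL l by omega))
    have h3 := algebraMap_ne_zero (isCyclotomicProduct_hookL l)
    rw [plucks, List.map_map]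
    have key : ∀ p ∈ plucksL l, ((fun p : ℕ × PTree => φ (X ^ p.1) / φ (hook p.2)) ∘
        fun p : ℕ × List PTree => (p.1, PTree.node p.2)) p =
          φ (X ^ p.1) / φ (hookL p.2) * (φ (qInt (verticesL l)))⁻¹ := by
      intro p hp
      have h := verticesL_of_mem_plucksL l p hp
      simp only [Function.comp_apply, hook]
      rw [show 1 + verticesL p.2 = verticesL l by omega, map_mul]
      simp only [div_eq_mul_inv, mul_inv]
      ring
    rw [List.map_congr_left key, List.sum_map_mul_right, sum_plucksL_div_hookL l, hook, vertices,
      map_mul]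
    field_simp
/-- The pluckings of a forest, weighted by inverse hook products. -/
theorem sum_plucksL_div_hookL : ∀ l : List PTree,
    ((plucksL l).map fun p => φ (X ^ p.1) / φ (hookL p.2)).sum =
      φ (qInt (verticesL l)) / φ (hookL l)
  | [] => by simp [plucksL, verticesL, qInt]
  | t :: ts => by
    have ht := algebraMap_ne_zero (isCyclotomicProduct_hook t)
    have hts := algebraMap_ne_zero (isCyclotomicProduct_hookL ts)
    have tail : (((plucksL ts).map fun p => (p.1, t :: p.2)).map
        fun p => φ (X ^ p.1) / φ (hookL p.2)).sum =
          φ (qInt (verticesL ts)) / (φ (hook t) * φ (hookL ts)) := by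
      rw [List.map_map]
      have key : ∀ p ∈ plucksL ts, ((fun p : ℕ × List PTree => φ (X ^ p.1) / φ (hookL p.2)) ∘
          fun p : ℕ × List PTree => (p.1, t :: p.2)) p =
            φ (X ^ p.1) / φ (hookL p.2) * (φ (hook t))⁻¹ := by
        intro p _
        simp only [Function.comp_apply, hookL, map_mul, div_eq_mul_inv, mul_inv]
        ring
      rw [List.map_congr_left key, List.sum_map_mul_right, sum_plucksL_div_hookL ts]
      field_simp
    rw [verticesL, add_comm (vertices t), qInt_add]
    match t, ht, tail with
    | .node [], ht, tail =>
      rw [plucksL, List.map_append, List.sum_append, tail]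
      simp [hook, hookL, verticesL, vertices, qInt]
      ring
    | .node (s :: ss), ht, tail =>
      rw [plucksL, List.map_append, List.sum_append, tail, List.map_map]
      have key : ∀ p ∈ plucks (.node (s :: ss)),
          ((fun p : ℕ × List PTree => φ (X ^ p.1) / φ (hookL p.2)) ∘
            fun p : ℕ × PTree => (p.1 + verticesL ts, p.2 :: ts)) p =
              φ (X ^ p.1) / φ (hook p.2) * (φ (X ^ verticesL ts) * (φ (hookL ts))⁻¹) := by
        intro p _
        simp only [Function.comp_apply, hookL, map_mul, pow_add, div_eq_mul_inv, mul_inv]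
        ring
      rw [List.map_congr_left key, List.sum_map_mul_right,
        sum_plucks_div_hook (.node (s :: ss)) (by rw [edges, edgesL]; omega), hookL, map_mul,
        map_add, map_mul]
      field_simp
      ring
end

/-- The hook length formula for the plucking polynomial. -/
theorem Qfuel_node_mul_hookL (k : ℕ) :
    ∀ l : List PTree, edgesL l = k → Qfuel k (.node l) * hookL l = qFact k := by
  induction k with
  | zero =>
    rintro (_ | ⟨t, ts⟩) hl
    · simp [Qfuel, hookL, qFact]
    · rw [edgesL] at hl
      omega
  | succ k ih =>
    intro l hl
    have hne := algebraMap_ne_zero (isCyclotomicProduct_hookL l)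
    apply IsFractionRing.injective ℤ[X] (FractionRing ℤ[X])
    rw [Qfuel, if_neg (by rw [edges]; omega), plucks, List.map_map, map_mul, map_list_sum,
      List.map_map]
    have key : ∀ p ∈ plucksL l, (φ ∘ ((fun p : ℕ × PTree => X ^ p.1 * Qfuel k p.2) ∘
        fun p : ℕ × List PTree => (p.1, PTree.node p.2))) p =
          φ (X ^ p.1) / φ (hookL p.2) * φ (qFact k) := by
      intro p hp
      have h := verticesL_of_mem_plucksL l p hp
      rw [verticesL_eq_edgesL, verticesL_eq_edgesL] at h
      have hp' := algebraMap_ne_zero (isCyclotomicProduct_hookL p.2)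
      rw [← ih p.2 (by omega)]
      simp only [Function.comp_apply, map_mul]
      field_simp
    rw [List.map_congr_left key, List.sum_map_mul_right, sum_plucksL_div_hookL,
      verticesL_eq_edgesL, hl, qFact, map_mul]
    field_simp

end PTree

/-- For every plane rooted tree `T`, the plucking polynomial `Q(T)` is a product of
cyclotomic polynomials: there is a finite multiset of positive integers `d₁, …, d_s`
with `Q(T) = Π_{j=1}^{s} Φ_{dⱼ}(q)` in `ℤ[q]`. -/
theorem plucking_product_of_cyclotomics (t : PTree) :
    ∃ ds : Multiset ℕ, (∀ d ∈ ds, 0 < d) ∧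
      PTree.Q t = (ds.map (fun d => Polynomial.cyclotomic d ℤ)).prod := by
  obtain ⟨l⟩ := t
  refine IsCyclotomicProduct.of_mul (PTree.isCyclotomicProduct_hookL l) ?_
  rw [PTree.Q, PTree.edges, PTree.Qfuel_node_mul_hookL _ l rfl]
  exact .qFact _
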